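/- arXiv:1511.08416 — 3 statements merged into one kernel-verified Lean document; each statement's English description precedes it below -/
import Mathlib

section
/- In any tournament on n players with n a power of two, every superking (a king v such that every player that beats v is itself beaten by at least log₂ n players that v beats) is an SE winner. -/
/-- A tournament relation on `V`: irreflexive, asymmetric, and total. -/
structure IsTournament {V : Type*} (beats : V → V → Prop) : Prop where
  irrefl : ∀ v, ¬ beats v v
  asymm : ∀ u v, beats u v → ¬ beats v u
  total : ∀ u v, u ≠ v → beats u v ∨ beats v u

/-- `SEWinner beats S v` : the player `v` can win a balanced single-elimination
tournament among the players of `S` under some seeding.  Either `S = {v}`, or `S`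
can be partitioned into pairs (via a fixed-point-free involution `f` of `S`) such
that `v` is an SE winner of the set `W` of winners of the pairs. -/
inductive SEWinner {V : Type*} (beats : V → V → Prop) : Finset V → V → Prop
  | single (v : V) : SEWinner beats {v} v
  | round (S W : Finset V) (f : V → V) (v : V)
      (hf : ∀ x ∈ S, f x ∈ S ∧ f x ≠ x ∧ f (f x) = x)
      (hW : ∀ x, x ∈ W ↔ x ∈ S ∧ beats x (f x))
      (hw : SEWinner beats W v) : SEWinner beats S v

/-- A king: every other player is beaten by `v` or by someone `v` beats. -/
def IsKing {V : Type*} (beats : V → V → Prop) (v : V) : Prop :=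
  ∀ u, u ≠ v → beats v u ∨ ∃ w, beats v w ∧ beats w u

/-- A 3-king: every other player is reachable from `v` in at most 3 steps. -/
def IsThreeKing {V : Type*} (beats : V → V → Prop) (v : V) : Prop :=
  ∀ u, u ≠ v → beats v u ∨ (∃ w, beats v w ∧ beats w u) ∨
    ∃ w x, beats v w ∧ beats w x ∧ beats x u

/-- The out-degree of a player. -/
noncomputable def outDeg {V : Type*} [Fintype V] (beats : V → V → Prop) (v : V) : ℕ :=
  {u | beats v u}.ncard

/-- The number of directed `k`-paths originating at `v`. -/
noncomputable def kPathCount {V : Type*} [Fintype V] (beats : V → V → Prop) (k : ℕ) (v : V) : ℕ :=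
  {p : Fin (k + 1) → V | Function.Injective p ∧ p 0 = v ∧
    ∀ i : Fin k, beats (p i.castSucc) (p i.succ)}.ncard

/-- A superking: a king `v` such that every player beating `v` is beaten by at
least `log₂ n` players whom `v` beats. -/
def IsSuperking {V : Type*} [Fintype V] (beats : V → V → Prop) (v : V) : Prop :=
  IsKing beats v ∧ ∀ u, beats u v →
    Real.logb 2 (Fintype.card V) ≤ ({w | beats v w ∧ beats w u}.ncard : ℝ)

open Classical in
/-- `Rnd beats S W`: the set `S` can be paired up so that `W` is the set of winners. -/
inductive Rnd {V : Type*} (beats : V → V → Prop) : Finset V → Finset V → Prop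
  | nil : Rnd beats ∅ ∅
  | cons (S W : Finset V) (x y : V) (hx : x ∉ S) (hy : y ∉ S) (hb : beats x y)
      (h : Rnd beats S W) : Rnd beats (insert x (insert y S)) (insert x W)

theorem Rnd.subset {V : Type*} {beats : V → V → Prop} {S W : Finset V}
    (h : Rnd beats S W) : W ⊆ S := by
  induction h with
  | nil => simp
  | cons S W x y hx hy hb h ih =>
    intro z hz
    simp only [Finset.mem_insert] at hz ⊢
    rcases hz with hz | hz
    · exact Or.inl hz
    · exact Or.inr (Or.inr (ih hz))

theorem Rnd.card {V : Type*} {beats : V → V → Prop} (hT : IsTournament beats) {S W : Finset V}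
    (h : Rnd beats S W) : S.card = 2 * W.card := by
  classical
  induction h with
  | nil => simp
  | cons S W x y hx hy hb h ih =>
    have hxy : x ≠ y := by rintro rfl; exact hT.irrefl _ hb
    have hxW : x ∉ W := fun hh => hx (h.subset hh)
    have e1 : (insert x (insert y S)).card = S.card + 2 := by
      rw [Finset.card_insert_of_notMem (by simp [hxy, hx]), Finset.card_insert_of_notMem hy]
    have e2 : (insert x W).card = W.card + 1 := Finset.card_insert_of_notMem hxW
    omega

theorem Rnd.exists_fun {V : Type*} {beats : V → V → Prop} (hT : IsTournament beats)
    {S W : Finset V} (h : Rnd beats S W) :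
    ∃ f : V → V, (∀ x ∈ S, f x ∈ S ∧ f x ≠ x ∧ f (f x) = x) ∧
      ∀ x, x ∈ W ↔ x ∈ S ∧ beats x (f x) := by
  classical
  induction h with
  | nil => exact ⟨id, by simp, by simp⟩
  | cons S W x y hx hy hb h ih =>
    obtain ⟨f, hf, hW⟩ := ih
    have hxy : x ≠ y := by rintro rfl; exact hT.irrefl _ hb
    have hyx := hT.asymm _ _ hb
    refine ⟨fun z => if z = x then y else if z = y then x else f z, ?_, ?_⟩
    · intro z hz
      simp only [Finset.mem_insert] at hz ⊢
      by_cases h1 : z = x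
      · subst h1; simp [hxy.symm]
      by_cases h2 : z = y
      · subst h2; simp [hxy, hxy.symm]
      have hzS : z ∈ S := by tauto
      obtain ⟨a, b, c⟩ := hf z hzS
      have h3 : f z ≠ x := by rintro h; rw [h] at a; exact hx a
      have h4 : f z ≠ y := by rintro h; rw [h] at a; exact hy a
      simp [h1, h2, h3, h4, a, b, c]
    · intro z
      simp only [Finset.mem_insert]
      by_cases h1 : z = x
      · subst h1; simp [hb]
      by_cases h2 : z = y
      · subst h2
        have : z ∉ W := fun hh => hy (h.subset hh)
        simp [h1, this, hyx]
      simp [h1, h2, hW]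

theorem exists_rnd {V : Type*} {beats : V → V → Prop} (hT : IsTournament beats) (v : V)
    (n : ℕ) : ∀ T : Finset V, T.card = 2 * n → ∃ W, Rnd beats T W ∧
      ∀ y ∈ W, beats y v → ∀ x ∈ T, beats v x → beats x y → x ∈ W := by
  classical
  induction n with
  | zero =>
    intro T h
    have : T = ∅ := by simpa using h
    subst this
    exact ⟨∅, Rnd.nil, by simp⟩
  | succ n ih =>
    intro T hc
    have key : ∀ x ∈ T, ∀ y ∈ T, beats x y → ((T.erase x).erase y).card = 2 * n ∧
        insert x (insert y ((T.erase x).erase y)) = T := by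
      intro x hx y hy hb
      have hxy : x ≠ y := by rintro rfl; exact hT.irrefl _ hb
      have hy' : y ∈ T.erase x := Finset.mem_erase.2 ⟨hxy.symm, hy⟩
      refine ⟨?_, ?_⟩
      · rw [Finset.card_erase_of_mem hy', Finset.card_erase_of_mem hx]; omega
      · rw [Finset.insert_erase hy', Finset.insert_erase hx]
    by_cases hex : ∃ x ∈ T, ∃ y ∈ T, beats x y ∧ beats v x ∧ beats y v
    · obtain ⟨x, hx, y, hy, hb, hvx, hyv⟩ := hex
      obtain ⟨h1, h2⟩ := key x hx y hy hb
      obtain ⟨W, hR, hW⟩ := ih _ h1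
      refine ⟨insert x W, ?_, ?_⟩
      · have := Rnd.cons _ _ x y (by simp) (by simp) hb hR
        rwa [h2] at this
      · intro y' hy' hyv' x' hx' hvx' hb'
        rw [Finset.mem_insert] at hy' ⊢
        rcases hy' with rfl | hy'
        · exact absurd hyv' (hT.asymm _ _ hvx)
        by_cases hxx : x' = x
        · exact Or.inl hxx
        refine Or.inr (hW y' hy' hyv' x' ?_ hvx' hb')
        have : x' ≠ y := by rintro rfl; exact hT.asymm _ _ hvx' hyv
        simp [this, hxx, hx']
    · have : 1 < T.card := by omega
      obtain ⟨a, ha, b, hb, hab⟩ := Finset.one_lt_card.1 this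
      have : ∃ x ∈ T, ∃ y ∈ T, beats x y := by
        rcases hT.total a b hab with h | h
        · exact ⟨a, ha, b, hb, h⟩
        · exact ⟨b, hb, a, ha, h⟩
      obtain ⟨x, hx, y, hy, hb⟩ := this
      obtain ⟨h1, h2⟩ := key x hx y hy hb
      obtain ⟨W, hR, -⟩ := ih _ h1
      have hR' := Rnd.cons _ _ x y (by simp) (by simp) hb hR
      have hR2 : Rnd beats T (insert x W) := by
        rwa [h2] at hR'
      refine ⟨insert x W, hR2, ?_⟩
      intro y' hy' hyv' x' hx' hvx' hb'
      exact absurd ⟨x', hx', y', hR2.subset hy', hb', hvx', hyv'⟩ hex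

open Classical in
theorem superking_aux {V : Type*} {beats : V → V → Prop} (hT : IsTournament beats) (v : V)
    (k : ℕ) : ∀ S : Finset V, v ∈ S → S.card = 2 ^ k →
      (∀ u ∈ S, beats u v → k ≤ (S.filter (fun w => beats v w ∧ beats w u)).card) →
      SEWinner beats S v := by
  induction k with
  | zero =>
    intro S hv hc _
    obtain ⟨a, rfl⟩ := Finset.card_eq_one.1 (by simpa using hc)
    have : v = a := by simpa using hv
    subst this
    exact SEWinner.single v
  | succ k ih =>
    intro S hv hc hS
    have hpos : 0 < 2 ^ k := by positivity
    rw [pow_succ] at hc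
    have ha0 : ∃ a ∈ S, beats v a := by
      obtain ⟨u, hu, huv⟩ := Finset.exists_mem_ne (by omega : 1 < S.card) v
      rcases hT.total v u huv.symm with h | h
      · exact ⟨u, hu, h⟩
      · have := hS u hu h
        obtain ⟨w, hw⟩ := Finset.card_pos.1 (by omega :
          0 < (S.filter (fun w => beats v w ∧ beats w u)).card)
        simp only [Finset.mem_filter] at hw
        exact ⟨w, hw.1, hw.2.1⟩
    obtain ⟨a, ha, hva⟩ := ha0
    have hav : a ≠ v := by rintro rfl; exact hT.irrefl _ hva
    have ha' : a ∈ S.erase v := Finset.mem_erase.2 ⟨hav, ha⟩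
    have hTc : ((S.erase v).erase a).card = 2 * (2 ^ k - 1) := by
      rw [Finset.card_erase_of_mem ha', Finset.card_erase_of_mem hv]; omega
    obtain ⟨W, hR, hW⟩ := exists_rnd hT v _ _ hTc
    have hR2 : Rnd beats S (insert v W) := by
      have := Rnd.cons _ _ v a (by simp) (by simp) hva hR
      rwa [Finset.insert_erase ha', Finset.insert_erase hv] at this
    obtain ⟨f, hf, hfW⟩ := hR2.exists_fun hT
    refine SEWinner.round S (insert v W) f v hf hfW (ih _ (by simp) ?_ ?_)
    · have := hR2.card hT
      omega
    · intro u hu huv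
      have h1 := hS u (hR2.subset hu) huv
      have huW : u ∈ W := by
        rcases Finset.mem_insert.1 hu with rfl | h
        · exact absurd huv (hT.irrefl _)
        · exact h
      have hsub : (S.filter (fun w => beats v w ∧ beats w u)).erase a ⊆
          (insert v W).filter (fun w => beats v w ∧ beats w u) := by
        intro w hw
        simp only [Finset.mem_erase, Finset.mem_filter] at hw
        obtain ⟨hwa, hwS, hvw, hwu⟩ := hw
        have hwv : w ≠ v := by rintro rfl; exact hT.irrefl _ hvw
        simp only [Finset.mem_filter, Finset.mem_insert]
        exact ⟨Or.inr (hW u huW huv w (by simp [hwa, hwv, hwS]) hvw hwu), hvw, hwu⟩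
      have h2 := Finset.card_le_card hsub
      have h3 := Finset.pred_card_le_card_erase (a := a)
        (s := S.filter (fun w => beats v w ∧ beats w u))
      omega

/-- every superking is an SE winner. -/
theorem superking_SE_winner {V : Type*} [Fintype V]
    (beats : V → V → Prop) (hT : IsTournament beats)
    (k : ℕ) (hcard : Fintype.card V = 2 ^ k)
    (v : V) (hv : IsSuperking beats v) :
    SEWinner beats Finset.univ v := by
  classical
  refine superking_aux hT v k _ (Finset.mem_univ v) (by rw [Finset.card_univ, hcard]) ?_
  intro u _ huv
  have h := hv.2 u huv
  have e : Real.logb 2 ((Fintype.card V : ℕ) : ℝ) = k := by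
    rw [hcard]; push_cast
    rw [Real.logb_pow, Real.logb_self_eq_one (by norm_num), mul_one]
  rw [e] at h
  have h' : k ≤ {w | beats v w ∧ beats w u}.ncard := by exact_mod_cast h
  rw [Set.ncard_eq_toFinset_card'] at h'
  convert h' using 2
  ext w
  simp
end

section
/- In any tournament on n players, for every integer k with 0 ≤ k ≤ n − 1, any player that maximizes the number of directed k-paths originating from it is the origin of at least (1/n)·C(n, k+1) directed k-paths. -/
theorem redei_aux {V : Type*} {beats : V → V → Prop} (hT : IsTournament beats) (a : V) :
    ∀ (l : List V) (c : V), (c :: l).IsChain beats → beats c a → a ∉ l →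
      ∃ l' : List V, l'.Perm (a :: l) ∧ (c :: l').IsChain beats := by
  intro l
  induction l with
  | nil =>
    intro c _ hca _
    exact ⟨[a], List.Perm.refl _, by simpa using hca⟩
  | cons b t ih =>
    intro c hc hca ha
    rw [List.isChain_cons_cons] at hc
    have hab : a ≠ b := fun h => ha (by simp [h])
    rcases hT.total a b hab with h | h
    · refine ⟨a :: b :: t, List.Perm.refl _, ?_⟩
      rw [List.isChain_cons_cons, List.isChain_cons_cons]
      exact ⟨hca, h, hc.2⟩
    · obtain ⟨l', hp, hl'⟩ := ih b hc.2 h (fun h => ha (by simp [h]))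
      refine ⟨b :: l', (hp.cons b).trans (List.Perm.swap _ _ _), ?_⟩
      rw [List.isChain_cons_cons]
      exact ⟨hc.1, hl'⟩

theorem redei_list {V : Type*} {beats : V → V → Prop} (hT : IsTournament beats) (l : List V)
    (hl : l.Nodup) : ∃ l' : List V, l'.Perm l ∧ l'.IsChain beats := by
  induction l with
  | nil => exact ⟨[], List.Perm.refl _, by simp⟩
  | cons a t ih =>
    rw [List.nodup_cons] at hl
    obtain ⟨m, hp, hm⟩ := ih hl.2
    have ha : a ∉ m := fun h => hl.1 (hp.mem_iff.1 h)
    cases m with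
    | nil => exact ⟨[a], hp.cons a, by simp⟩
    | cons b s =>
      have hab : a ≠ b := fun h => ha (by simp [h])
      rcases hT.total a b hab with h | h
      · refine ⟨a :: b :: s, hp.cons a, ?_⟩
        rw [List.isChain_cons_cons]
        exact ⟨h, hm⟩
      · obtain ⟨l', hp', hl'⟩ := redei_aux hT a s b hm h (fun h => ha (by simp [h]))
        exact ⟨b :: l', ((hp'.cons b).trans (List.Perm.swap _ _ _)).trans (hp.cons a), hl'⟩

theorem redei_fun {V : Type*} {beats : V → V → Prop} (hT : IsTournament beats) (k : ℕ)
    (S : Finset V) (hS : S.card = k + 1) :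
    ∃ p : Fin (k + 1) → V, Set.range p = (S : Set V) ∧ Function.Injective p ∧
      ∀ i : Fin k, beats (p i.castSucc) (p i.succ) := by
  obtain ⟨l, hp, hl⟩ := redei_list hT S.toList S.nodup_toList
  have hlen : l.length = k + 1 := by rw [hp.length_eq, Finset.length_toList, hS]
  have hnd : l.Nodup := hp.nodup_iff.2 S.nodup_toList
  refine ⟨fun i => l.get (i.cast hlen.symm), ?_, ?_, ?_⟩
  · ext x
    have : x ∈ (S : Set V) ↔ x ∈ l := by rw [hp.mem_iff]; simp
    rw [this, List.mem_iff_get]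
    constructor
    · rintro ⟨i, rfl⟩
      exact ⟨_, rfl⟩
    · rintro ⟨i, rfl⟩
      exact ⟨i.cast hlen, rfl⟩
  · intro i j hij
    have := List.nodup_iff_injective_get.1 hnd hij
    exact Fin.cast_injective _ this
  · intro i
    rw [List.isChain_iff_getElem] at hl
    exact hl i.1 (by have := i.2; omega)

theorem sum_kPathCount {V : Type*} [Fintype V] {beats : V → V → Prop} (hT : IsTournament beats)
    (k : ℕ) : (Fintype.card V).choose (k + 1) ≤ ∑ u : V, kPathCount beats k u := by
  classical
  let P : Finset (Fin (k + 1) → V) := Finset.univ.filter fun p =>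
    Function.Injective p ∧ ∀ i : Fin k, beats (p i.castSucc) (p i.succ)
  have h1 : ∑ u : V, kPathCount beats k u = P.card := by
    rw [Finset.card_eq_sum_card_fiberwise (f := fun p => p 0) (t := Finset.univ)
      (fun _ _ => by simp)]
    refine Finset.sum_congr rfl fun u _ => ?_
    rw [kPathCount, ← Set.ncard_coe_finset]
    congr 1
    ext p
    simp only [P, Set.mem_setOf_eq, Finset.coe_filter, Finset.mem_filter, Finset.mem_univ,
      true_and]
    tauto
  have h2 : (Finset.powersetCard (k + 1) (Finset.univ : Finset V)) ⊆
      P.image (fun p => Finset.univ.image p) := by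
    intro S hS
    obtain ⟨p, hr, hi, hb⟩ := redei_fun hT k S (Finset.mem_powersetCard.1 hS).2
    rw [Finset.mem_image]
    refine ⟨p, by simp [P, hi, hb], ?_⟩
    rw [← Finset.coe_inj, ← hr]
    simp
  rw [h1]
  calc _ = (Finset.powersetCard (k + 1) (Finset.univ : Finset V)).card := by
        rw [Finset.card_powersetCard, Finset.card_univ]
    _ ≤ _ := (Finset.card_le_card h2).trans Finset.card_image_le

/-- a player maximizing the number of `k`-paths originating from it
is the origin of at least `(1/n)·C(n, k+1)` directed `k`-paths. -/
theorem max_kpaths_lower_bound {V : Type*} [Fintype V]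
    (beats : V → V → Prop) (hT : IsTournament beats)
    (k : ℕ) (hk : k ≤ Fintype.card V - 1)
    (v : V) (hmax : ∀ u : V, kPathCount beats k u ≤ kPathCount beats k v) :
    (((Fintype.card V).choose (k + 1) : ℝ)) / (Fintype.card V : ℝ) ≤
      (kPathCount beats k v : ℝ) := by
  have h := (sum_kPathCount hT k).trans (Finset.sum_le_card_nsmul Finset.univ _ _
    (fun u _ => hmax u))
  have hpos : (0 : ℝ) < Fintype.card V := by
    exact_mod_cast Fintype.card_pos_iff.2 ⟨v⟩
  rw [div_le_iff₀ hpos, mul_comm]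
  rw [Finset.card_univ, smul_eq_mul] at h
  exact_mod_cast h
end

section
/- Let n ≥ 4 be a power of two and let T be the tournament on players 1, …, n in which i beats j whenever i < j, except that player n beats player 1. Then the lottery that puts probability 1/3 on each of players 1, 2, and n is a maximal lottery of T (so player n belongs to the bipartisan set of T), yet player n is not an SE winner of T. -/
theorem SEWinner.mem_self {V : Type*} {beats : V → V → Prop} {S : Finset V} {v : V}
    (h : SEWinner beats S v) : v ∈ S := by
  induction h with
  | single v => simp
  | round S W f v hf hW hw ih => exact ((hW v).1 ih).1

/-- in the "almost transitive" tournament on `n ≥ 4` players (player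
`i` beats player `j` whenever `i < j`, except that the last player beats the first),
the lottery putting probability `1/3` on each of the first, second, and last players
is a maximal lottery — so the last player is in the bipartisan set — yet the last
player is not an SE winner. -/
theorem bipartisan_not_SE_winner (n m : ℕ) (hn : n = 2 ^ m) (h4 : 4 ≤ n)
    (beats : Fin n → Fin n → Prop)
    (hbeats : ∀ i j : Fin n, beats i j ↔
      (((i : ℕ) < (j : ℕ) ∧ ¬((i : ℕ) = 0 ∧ (j : ℕ) = n - 1)) ∨
        ((i : ℕ) = n - 1 ∧ (j : ℕ) = 0)))
    (M : Matrix (Fin n) (Fin n) ℝ)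
    (hM1 : ∀ u v : Fin n, beats u v → M u v = 1)
    (hM2 : ∀ u v : Fin n, beats v u → M u v = -1)
    (hM3 : ∀ v : Fin n, M v v = 0)
    (q : Fin n → ℝ)
    (hq : ∀ i : Fin n, q i =
      if (i : ℕ) = 0 ∨ (i : ℕ) = 1 ∨ (i : ℕ) = n - 1 then 1 / 3 else 0) :
    (∀ i, 0 ≤ q i) ∧ (∑ i, q i = 1) ∧ (∀ j : Fin n, 0 ≤ ∑ u, q u * M u j) ∧
      0 < q ⟨n - 1, by omega⟩ ∧
      ¬ SEWinner beats Finset.univ ⟨n - 1, by omega⟩ := by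
  obtain ⟨z, hz⟩ : ∃ z : Fin n, (z : ℕ) = 0 := ⟨⟨0, by omega⟩, rfl⟩
  obtain ⟨o, ho⟩ : ∃ z : Fin n, (z : ℕ) = 1 := ⟨⟨1, by omega⟩, rfl⟩
  obtain ⟨l, hl⟩ : ∃ l : Fin n, l = ⟨n - 1, by omega⟩ := ⟨_, rfl⟩
  have hlv : (l : ℕ) = n - 1 := by rw [hl]
  rw [← hl]
  have hq' : ∀ i, q i = (if i = z then 1 / 3 else 0) + (if i = o then 1 / 3 else 0)
      + (if i = l then 1 / 3 else 0) := by
    intro i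
    rw [hq]
    simp only [Fin.ext_iff, hz, ho, hlv]
    split_ifs <;> first | omega | norm_num
  have hsum : ∀ g : Fin n → ℝ, ∑ u, q u * g u = 1 / 3 * (g z + g o + g l) := by
    intro g
    simp only [hq', add_mul, Finset.sum_add_distrib, ite_mul, zero_mul, Finset.sum_ite_eq',
      Finset.sum_ite_eq, Finset.mem_univ, if_true]
    ring
  refine ⟨?_, ?_, ?_, ?_, ?_⟩
  · intro i
    rw [hq]
    split_ifs <;> norm_num
  · have h := hsum (fun _ => 1)
    simp only [mul_one] at h
    rw [h]
    norm_num
  · intro j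
    rw [hsum (fun u => M u j)]
    have hzo : beats z o := by rw [hbeats]; omega
    have hol : beats o l := by rw [hbeats]; omega
    have hlz : beats l z := by rw [hbeats]; omega
    by_cases h1 : j = z
    · subst h1
      simp [hM3, hM2 _ _ hzo, hM1 _ _ hlz]
    by_cases h2 : j = o
    · subst h2
      simp [hM3, hM1 _ _ hzo, hM2 _ _ hol]
    by_cases h3 : j = l
    · subst h3
      simp [hM3, hM1 _ _ hol, hM2 _ _ hlz]
    have hj := j.isLt
    rw [Fin.ext_iff] at h1 h2 h3
    have a : beats z j := by rw [hbeats]; omega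
    have b : beats o j := by rw [hbeats]; omega
    have c : beats j l := by rw [hbeats]; omega
    rw [hM1 _ _ a, hM1 _ _ b, hM2 _ _ c]
    norm_num
  · rw [hq, if_pos (by omega)]
    norm_num
  · intro h
    have key : ∀ x, beats l x → x = z := by
      intro x hx
      have := x.isLt
      rw [hbeats] at hx
      apply Fin.ext
      omega
    generalize hS : (Finset.univ : Finset (Fin n)) = S at h
    cases h with
    | single =>
      have : o ∈ ({l} : Finset (Fin n)) := by rw [← hS]; exact Finset.mem_univ o
      rw [Finset.mem_singleton, Fin.ext_iff] at this
      omega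
    | round _ W f _ hf hW hw =>
      have hall : ∀ x, x ∈ S := by intro x; rw [← hS]; exact Finset.mem_univ x
      have hfl : f l = z := key _ ((hW l).1 hw.mem_self).2
      have hfz : f z = l := by rw [← hfl]; exact (hf l (hall l)).2.2
      cases hw with
      | single =>
        have hoW : o ∈ ({l} : Finset (Fin n)) := by
          rw [hW]
          refine ⟨hall o, ?_⟩
          obtain ⟨-, h1, h2⟩ := hf o (hall o)
          have h3 : f o ≠ z := by
            intro h; rw [h, hfz, Fin.ext_iff] at h2; omega
          have h4' : f o ≠ l := by
            intro h; rw [h, hfl, Fin.ext_iff] at h2; omega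
          rw [ne_eq, Fin.ext_iff] at h1 h3 h4'
          rw [hbeats]
          omega
        rw [Finset.mem_singleton, Fin.ext_iff] at hoW
        omega
      | round _ W' f' _ hf' hW' hw' =>
        have h1 := (hW' l).1 hw'.mem_self
        have h2 : f' l = z := key _ h1.2
        have h3 : z ∈ W := by rw [← h2]; exact (hf' l h1.1).1
        have h4' := ((hW z).1 h3).2
        rw [hfz, hbeats] at h4'
        omega
end
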